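/- Let M be a Peano continuum and let G be a group acting on M as a geometrically finite convergence group. Then no ∼-class in M*(2) is a singleton; that is, for every x ∈ M*(2) there exists y ∈ M*(2) with y ≠ x and 𝒩(x,y) = 2. -/

import Mathlib

open Set Pointwise

/-- A generalized Peano continuum: a connected, locally compact, locally connected,
σ-compact, metrizable topological space. -/
structure IsGenPeanoContinuum (X : Type*) [TopologicalSpace X] : Prop where
  connectedSpace : ConnectedSpace X
  locallyCompactSpace : LocallyCompactSpace X
  locallyConnectedSpace : LocallyConnectedSpace X
  sigmaCompactSpace : SigmaCompactSpace X
  metrizableSpace : TopologicalSpace.MetrizableSpace X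

/-- An exhaustion of a space by compact sets. -/
structure IsExhaustion {X : Type*} [TopologicalSpace X] (C : ℕ → Set X) : Prop where
  isCompact : ∀ i, IsCompact (C i)
  subset_interior : ∀ i, C i ⊆ interior (C (i + 1))
  iUnion_eq : (⋃ i, C i) = Set.univ

/-- The space of ends of `X` with respect to the exhaustion `C`: the inverse limit of the
sets of connected components of the complements `X ∖ C i`, the bonding maps being induced
by inclusion. -/
def EndsSpace {X : Type*} [TopologicalSpace X] (C : ℕ → Set X) : Type _ :=
  { E : ℕ → Set X //
      (∀ i, ∃ x ∈ (C i)ᶜ, E i = connectedComponentIn (C i)ᶜ x) ∧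
        ∀ i, E (i + 1) ⊆ E i }

/-- `EndsSpace C` is topologized as a subspace of the product of the discrete spaces of
components. -/
instance EndsSpace.instTopologicalSpace {X : Type*} [TopologicalSpace X] (C : ℕ → Set X) :
    TopologicalSpace (EndsSpace C) :=
  TopologicalSpace.induced (fun E => (E.1 : ℕ → Set X))
    (@Pi.topologicalSpace ℕ (fun _ => Set X) fun _ => ⊥)

/-- `G` acts on `X` by homeomorphisms. -/
def ContinuousActionOn (G X : Type*) [Group G] [TopologicalSpace X] [MulAction G X] : Prop :=
  ∀ g : G, Continuous fun x : X => g • x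

/-- The action of `G` on `X` is proper: for every compact `K`, only finitely many translates
of `K` meet `K`. -/
def ProperActionOn (G X : Type*) [Group G] [TopologicalSpace X] [MulAction G X] : Prop :=
  ∀ K : Set X, IsCompact K → {g : G | ((g • K) ∩ K).Nonempty}.Finite

/-- The action of `G` on `X` is cocompact: the translates of some compact set cover `X`. -/
def CocompactActionOn (G X : Type*) [Group G] [TopologicalSpace X] [MulAction G X] : Prop :=
  ∃ K : Set X, IsCompact K ∧ (⋃ g : G, g • K) = Set.univ

universe u

/-- `x` is a global cut point: `M ∖ {x}` is disconnected. -/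
def IsGlobalCutPoint (M : Type*) [TopologicalSpace M] (x : M) : Prop :=
  ¬ IsPreconnected ({x}ᶜ : Set M)

/-- The valence of `x` equals the cardinal `n`: `M ∖ {x}` has exactly `n` ends (with respect
to any exhaustion). -/
def valenceEq {M : Type u} [TopologicalSpace M] (x : M) (n : Cardinal.{u}) : Prop :=
  ∀ C : ℕ → Set (({x}ᶜ : Set M)), IsExhaustion C → Cardinal.mk (EndsSpace C) = n

/-- The valence of `x` is at least `n`: `M ∖ {x}` has at least `n` ends (with respect to any
exhaustion). -/
def valenceGe {M : Type u} [TopologicalSpace M] (x : M) (n : Cardinal.{u}) : Prop :=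
  ∀ C : ℕ → Set (({x}ᶜ : Set M)), IsExhaustion C → n ≤ Cardinal.mk (EndsSpace C)

/-- `x` is a local cut point: `M ∖ {x}` is disconnected, or it is connected and has more
than one end. -/
def IsLocalCutPoint (M : Type u) [TopologicalSpace M] (x : M) : Prop :=
  ¬ IsPreconnected ({x}ᶜ : Set M) ∨
    (IsPreconnected ({x}ᶜ : Set M) ∧ valenceGe x 2)

/-- The sequence `g` converges to `α` locally uniformly on `M ∖ {β}`: for every compact
`C ⊆ M ∖ {β}` and every open neighborhood `U` of `α` we eventually have `g i • C ⊆ U`. -/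
def TendstoLocallyUniformlyAway {G M : Type*} [TopologicalSpace M] [SMul G M]
    (g : ℕ → G) (α β : M) : Prop :=
  ∀ C : Set M, IsCompact C → C ⊆ {β}ᶜ →
    ∀ U : Set M, IsOpen U → α ∈ U → ∃ N : ℕ, ∀ i : ℕ, N < i → (g i) • C ⊆ U

/-- The action of `G` on `M` is a convergence action: every sequence of distinct group
elements has a subsequence `g_{k_i}` and attracting/repelling points `α, β ∈ M` with
`g_{k_i} → α` locally uniformly on `M ∖ {β}` and `g_{k_i}⁻¹ → β` locally uniformly on
`M ∖ {α}`. -/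
def IsConvergenceAction (G M : Type*) [Group G] [TopologicalSpace M] [MulAction G M] : Prop :=
  ∀ g : ℕ → G, Function.Injective g →
    ∃ (α β : M) (φ : ℕ → ℕ), StrictMono φ ∧
      TendstoLocallyUniformlyAway (fun i => g (φ i)) α β ∧
      TendstoLocallyUniformlyAway (fun i => (g (φ i))⁻¹) β α

/-- `x` is a conical limit point: there are a sequence `(g n)` in `G` and distinct points
`α, β ∈ M` with `g n • x → α` while `g n • y → β` for every `y ≠ x`. -/
def IsConicalLimitPoint (G : Type*) {M : Type*} [Group G] [TopologicalSpace M]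
    [MulAction G M] (x : M) : Prop :=
  ∃ (g : ℕ → G) (α β : M), α ≠ β ∧
    Filter.Tendsto (fun n => g n • x) Filter.atTop (nhds α) ∧
    ∀ y : M, y ≠ x → Filter.Tendsto (fun n => g n • y) Filter.atTop (nhds β)

/-- `g` is loxodromic: it has infinite order and fixes exactly two points of `M`. -/
def IsLoxodromic (G : Type*) (M : Type*) [Group G] [TopologicalSpace M] [MulAction G M]
    (g : G) : Prop :=
  ¬ IsOfFinOrder g ∧ ∃ a b : M, a ≠ b ∧ {x : M | g • x = x} = {a, b}

/-- `p` is a parabolic point: it is the unique point stabilized by some infinite subgroup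
of `G` containing no loxodromic elements. -/
def IsParabolicPoint (G : Type*) {M : Type*} [Group G] [TopologicalSpace M]
    [MulAction G M] (p : M) : Prop :=
  ∃ P : Subgroup G, (P : Set G).Infinite ∧ (∀ g ∈ P, ¬ IsLoxodromic G M g) ∧
    {x : M | ∀ g ∈ P, g • x = x} = {p}

/-- `p` is a bounded parabolic point: a parabolic point whose stabilizer acts properly and
cocompactly on `M ∖ {p}`. -/
def IsBoundedParabolicPoint (G : Type*) {M : Type*} [Group G] [TopologicalSpace M]
    [MulAction G M] (p : M) : Prop :=
  IsParabolicPoint G p ∧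
    (∀ K : Set M, K ⊆ {p}ᶜ → IsCompact K →
      {g : G | g • p = p ∧ ((g • K) ∩ K).Nonempty}.Finite) ∧
    ∃ K : Set M, K ⊆ {p}ᶜ ∧ IsCompact K ∧ (⋃ g ∈ {g : G | g • p = p}, g • K) = {p}ᶜ

/-- The action of `G` on `M` is a geometrically finite convergence action: it is a
convergence action and every point of `M` is a conical limit point or a bounded parabolic
point. -/
def IsGeometricallyFinite (G M : Type*) [Group G] [TopologicalSpace M] [MulAction G M] :
    Prop :=
  IsConvergenceAction G M ∧
    ∀ x : M, IsConicalLimitPoint G x ∨ IsBoundedParabolicPoint G x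

/-- `𝒩(a,b)`: the number of connected components of `M ∖ {a, b}`. -/
def numComplementaryComponents (M : Type u) [TopologicalSpace M] (a b : M) : Cardinal.{u} :=
  Cardinal.mk (ConnectedComponents (({a, b}ᶜ : Set M)))

/-- The pair `{c, d}` separates the points `a` and `b`: both lie in `M ∖ {c, d}`, in
distinct connected components. -/
def PairSeparatesPoints (M : Type*) [TopologicalSpace M] (c d a b : M) : Prop :=
  a ∈ ({c, d}ᶜ : Set M) ∧ b ∈ ({c, d}ᶜ : Set M) ∧
    connectedComponentIn ({c, d}ᶜ : Set M) a ≠ connectedComponentIn ({c, d}ᶜ : Set M) b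

/-- The pairs `{a, b}` and `{c, d}` mutually separate: `c, d` lie in distinct components of
`M ∖ {a, b}` and `a, b` lie in distinct components of `M ∖ {c, d}`. -/
def MutuallySeparate (M : Type*) [TopologicalSpace M] (a b c d : M) : Prop :=
  PairSeparatesPoints M a b c d ∧ PairSeparatesPoints M c d a b

/-- `M*(2)`: the set of conical limit points of valence `2` which are not global cut
points. -/
def Mstar2 (G : Type*) (M : Type u) [Group G] [TopologicalSpace M] [MulAction G M] :
    Set M :=
  {x : M | IsConicalLimitPoint G x ∧ ¬ IsGlobalCutPoint M x ∧ valenceEq x 2}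

/-- `M*(3+)`: the set of conical limit points of valence `≥ 3` which are not global cut
points. -/
def Mstar3plus (G : Type*) (M : Type u) [Group G] [TopologicalSpace M] [MulAction G M] :
    Set M :=
  {x : M | IsConicalLimitPoint G x ∧ ¬ IsGlobalCutPoint M x ∧ valenceGe x 3}

/-- The relation `∼`: `x ∼ y` iff `x = y` or `𝒩(x,y) = 2`. -/
def SimRel {M : Type u} [TopologicalSpace M] (x y : M) : Prop :=
  x = y ∨ numComplementaryComponents M x y = 2

/-- The relation `≈` on `M*(3+)`: `a ≈ b` iff `a ≠ b` and
`𝒩(a,b) = val(a) = val(b) ≥ 3`. -/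
def ApproxRel {M : Type u} [TopologicalSpace M] (a b : M) : Prop :=
  a ≠ b ∧ ∃ n : Cardinal.{u}, 3 ≤ n ∧ numComplementaryComponents M a b = n ∧
    valenceEq a n ∧ valenceEq b n

open Filter Topology

/-- A family `U` of disjoint open sets, each accumulating at `x`, that together fill a punctured
neighbourhood of `x`. -/
structure IsLocalSplitting {M ι : Type*} [TopologicalSpace M] (x : M) (U : ι → Set M) : Prop where
  isOpen : ∀ i, IsOpen (U i)
  pairwise_disjoint : Pairwise (Function.onFun Disjoint U)
  notMem : ∀ i, x ∉ U i
  mem_closure : ∀ i, x ∈ closure (U i)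
  insert_mem_nhds : insert x (⋃ i, U i) ∈ 𝓝 x

theorem eq_of_mem_of_pairwise_disjoint {α ι : Type*} {U : ι → Set α}
    (hU : Pairwise (Function.onFun Disjoint U)) {i j : ι} {z : α} (hi : z ∈ U i) (hj : z ∈ U j) :
    i = j := by
  by_contra h
  exact Set.disjoint_left.1 (hU h) hi hj

theorem IsPreconnected.exists_subset_of_subset_iUnion {X ι : Type*} [TopologicalSpace X]
    {V : Set X} (hV : IsPreconnected V) (hne : V.Nonempty) {U : ι → Set X}
    (hU : ∀ i, IsOpen (U i)) (hd : Pairwise (Function.onFun Disjoint U)) (hVU : V ⊆ ⋃ i, U i) :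
    ∃ i, V ⊆ U i := by
  obtain ⟨z, hz⟩ := hne
  obtain ⟨i, hi⟩ := Set.mem_iUnion.1 (hVU hz)
  refine ⟨i, hV.subset_left_of_subset_union (v := ⋃ j ∈ ({i}ᶜ : Set ι), U j) (hU i)
    (isOpen_biUnion fun j _ => hU j) ?_ ?_ ⟨z, hz, hi⟩⟩
  · simp only [Set.disjoint_iUnion_right]
    intro j hj
    exact hd (Ne.symm hj)
  · intro w hw
    obtain ⟨j, hj⟩ := Set.mem_iUnion.1 (hVU hw)
    by_cases h : j = i
    · exact Or.inl (h ▸ hj)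
    · exact Or.inr (Set.mem_biUnion (show j ∈ ({i}ᶜ : Set ι) from h) hj)

namespace IsExhaustion

variable {X : Type*} [TopologicalSpace X] {C : ℕ → Set X}

/-- An exhaustion, as a bundled `CompactExhaustion`. -/
def toCompactExhaustion (hC : IsExhaustion C) : CompactExhaustion X :=
  ⟨C, hC.isCompact, hC.subset_interior, hC.iUnion_eq⟩

theorem mono (hC : IsExhaustion C) {m n : ℕ} (h : m ≤ n) : C m ⊆ C n :=
  hC.toCompactExhaustion.subset h

theorem exists_superset (hC : IsExhaustion C) {s : Set X} (hs : IsCompact s) : ∃ n, s ⊆ C n :=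
  hC.toCompactExhaustion.exists_superset_of_isCompact hs

end IsExhaustion

theorem CompactExhaustion.isExhaustion {X : Type*} [TopologicalSpace X] (K : CompactExhaustion X) :
    IsExhaustion (K : ℕ → Set X) :=
  ⟨K.isCompact, K.subset_interior_succ, K.iUnion_eq⟩

theorem exists_isExhaustion_compl_singleton {M : Type*} [MetricSpace M] [CompactSpace M] (x : M) :
    ∃ C : ℕ → Set (({x}ᶜ : Set M)), IsExhaustion C := by
  have : LocallyCompactSpace ({x}ᶜ : Set M) := isOpen_compl_singleton.locallyCompactSpace
  exact ⟨_, (CompactExhaustion.choice ({x}ᶜ : Set M)).isExhaustion⟩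

namespace EndsSpace

variable {X : Type*} [TopologicalSpace X] {C : ℕ → Set X}

theorem antitone (E : EndsSpace C) : Antitone E.1 := antitone_nat_of_succ_le E.2.2

theorem nonempty (E : EndsSpace C) (i : ℕ) : (E.1 i).Nonempty := by
  obtain ⟨x, hx, h⟩ := E.2.1 i
  exact h ▸ ⟨x, mem_connectedComponentIn hx⟩

theorem subset_compl (E : EndsSpace C) (i : ℕ) : E.1 i ⊆ (C i)ᶜ := by
  obtain ⟨x, hx, h⟩ := E.2.1 i
  exact h ▸ connectedComponentIn_subset _ _

theorem isPreconnected (E : EndsSpace C) (i : ℕ) : IsPreconnected (E.1 i) := by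
  obtain ⟨x, hx, h⟩ := E.2.1 i
  exact h ▸ isPreconnected_connectedComponentIn

theorem eq_of_mem (E : EndsSpace C) {i : ℕ} {z : X} (hz : z ∈ E.1 i) :
    E.1 i = connectedComponentIn (C i)ᶜ z := by
  obtain ⟨x, hx, h⟩ := E.2.1 i
  rw [h] at hz ⊢
  exact connectedComponentIn_eq hz

theorem isOpen [T2Space X] [LocallyConnectedSpace X] (hC : IsExhaustion C) (E : EndsSpace C)
    (i : ℕ) : IsOpen (E.1 i) := by
  obtain ⟨x, hx, h⟩ := E.2.1 i
  exact h ▸ (hC.isCompact i).isClosed.isOpen_compl.connectedComponentIn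

theorem eventually_disjoint {E E' : EndsSpace C} (h : E ≠ E') :
    ∀ᶠ i in atTop, Disjoint (E.1 i) (E'.1 i) := by
  obtain ⟨i, hi⟩ : ∃ i, E.1 i ≠ E'.1 i := by
    by_contra! h'
    exact h (Subtype.ext (funext h'))
  filter_upwards [eventually_ge_atTop i] with j hj
  refine Disjoint.mono (E.antitone hj) (E'.antitone hj) ?_
  rw [Set.disjoint_left]
  intro z hz hz'
  exact hi ((E.eq_of_mem hz).trans (E'.eq_of_mem hz').symm)

end EndsSpace

theorem mem_closure_image_end {M : Type*} [MetricSpace M] [CompactSpace M] {x : M}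
    {C : ℕ → Set (({x}ᶜ : Set M))} (hC : IsExhaustion C) (E : EndsSpace C)
    (i : ℕ) :
    x ∈ closure (Subtype.val '' E.1 i) := by
  rw [mem_closure_iff]
  intro O hO hxO
  have hK : IsCompact ((Subtype.val : ({x}ᶜ : Set M) → M) ⁻¹' Oᶜ) := by
    rw [Topology.IsEmbedding.subtypeVal.isCompact_iff, Subtype.image_preimage_coe,
      Set.inter_eq_right.2 (by rintro z hz rfl; exact hz hxO)]
    exact hO.isClosed_compl.isCompact
  obtain ⟨j, hj⟩ := hC.exists_superset hK
  obtain ⟨z, hz⟩ := E.nonempty (max i j)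
  refine ⟨z, ?_, z, E.antitone (le_max_left i j) hz, rfl⟩
  by_contra hzO
  exact E.subset_compl _ hz (hC.mono (le_max_right i j) (hj hzO))

section Valence

variable {M : Type*} [MetricSpace M] [CompactSpace M] [LocallyConnectedSpace M] {x : M}
  {C : ℕ → Set (({x}ᶜ : Set M))}

/-- Finitely many distinct ends of `M ∖ {x}` are separated by a local splitting at `x`, each piece
of which contains a connected set accumulating at `x`. -/
theorem exists_isLocalSplitting_of_injective {ι : Type*} [Finite ι] [Nonempty ι]
    (hC : IsExhaustion C) {e : ι → EndsSpace C} (he : Function.Injective e) :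
    ∃ U F : ι → Set M, IsLocalSplitting x U ∧
      ∀ i, F i ⊆ U i ∧ IsPreconnected (F i) ∧ x ∈ closure (F i) := by
  classical
  have hlc : LocallyConnectedSpace ({x}ᶜ : Set M) := isOpen_compl_singleton.locallyConnectedSpace
  have hemb : IsOpenEmbedding (Subtype.val : ({x}ᶜ : Set M) → M) :=
    isOpen_compl_singleton.isOpenEmbedding_subtypeVal
  obtain ⟨i₀⟩ := ‹Nonempty ι›
  obtain ⟨n, hn⟩ : ∃ n, ∀ i j, i ≠ j → Disjoint ((e i).1 n) ((e j).1 n) := by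
    have : ∀ᶠ n in atTop, ∀ i j, i ≠ j → Disjoint ((e i).1 n) ((e j).1 n) := by
      simp only [eventually_all]
      exact fun i j hij => EndsSpace.eventually_disjoint (he.ne hij)
    exact this.exists
  set W : ι → Set ({x}ᶜ : Set M) := fun i =>
    {z | z ∈ (C n)ᶜ ∧ (i = i₀ → ∀ j, j ≠ i₀ → z ∉ (e j).1 n) ∧ (i ≠ i₀ → z ∈ (e i).1 n)} with hW
  have hsub : ∀ i, (e i).1 n ⊆ W i := by
    intro i z hz
    refine ⟨(e i).subset_compl n hz, ?_, fun _ => hz⟩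
    rintro rfl j hj hzj
    exact Set.disjoint_left.1 (hn _ _ hj) hzj hz
  have hcl : ∀ i, IsClosed (((e i).1 n) ∪ C n) := by
    intro i
    rw [← isOpen_compl_iff, isOpen_iff_mem_nhds]
    intro z hz
    have hzC : z ∈ (C n)ᶜ := fun h => hz (Or.inr h)
    have ho : (C n)ᶜ ∈ 𝓝 z := (hC.isCompact n).isClosed.isOpen_compl.mem_nhds hzC
    filter_upwards [connectedComponentIn_mem_nhds ho] with w hw
    rintro (h | h)
    · apply hz
      left
      rw [(e i).eq_of_mem h, ← connectedComponentIn_eq hw]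
      exact mem_connectedComponentIn hzC
    · exact connectedComponentIn_subset _ _ hw h
  have hWo : ∀ i, IsOpen (W i) := by
    intro i
    by_cases hi : i = i₀
    · have : W i = (C n)ᶜ ∩ ⋂ j ∈ ({i₀}ᶜ : Set ι), (((e j).1 n) ∪ C n)ᶜ := by
        ext z
        simp only [hW, hi, Set.mem_ofPred_eq, Set.mem_inter_iff, Set.mem_iInter, Set.mem_compl_iff,
          Set.mem_union, Set.mem_singleton_iff]
        grind
      rw [this]
      exact (hC.isCompact n).isClosed.isOpen_compl.inter
        ((Set.toFinite _).isOpen_biInter fun j _ => (hcl j).isOpen_compl)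
    · have : W i = (e i).1 n :=
        Set.Subset.antisymm (fun z hz => hz.2.2 hi) (hsub i)
      rw [this]
      exact (e i).isOpen hC n
  refine ⟨fun i => Subtype.val '' W i, fun i => Subtype.val '' (e i).1 n,
    ⟨fun i => hemb.isOpenMap _ (hWo i), ?_, ?_, ?_, ?_⟩, ?_⟩
  · intro i j hij
    refine (Set.disjoint_image_iff Subtype.val_injective).2 (Set.disjoint_left.2 ?_)
    rintro z ⟨-, h1, h2⟩ ⟨-, h3, h4⟩
    by_cases hi : i = i₀
    · have hj : j ≠ i₀ := fun h => hij (hi.trans h.symm)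
      exact h1 hi j hj (h4 hj)
    · by_cases hj : j = i₀
      · exact h3 hj i hi (h2 hi)
      · exact Set.disjoint_left.1 (hn i j hij) (h2 hi) (h4 hj)
  · rintro i ⟨z, -, hz⟩
    exact z.2 hz
  · exact fun i => closure_mono (Set.image_mono (hsub i)) (mem_closure_image_end hC (e i) n)
  · have hK : IsCompact (Subtype.val '' C n) := (hC.isCompact n).image continuous_subtype_val
    have hx : (Subtype.val '' C n)ᶜ ∈ 𝓝 x := by
      refine hK.isClosed.isOpen_compl.mem_nhds ?_
      rintro ⟨z, -, hz⟩
      exact z.2 hz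
    filter_upwards [hx] with z hz
    by_cases hzx : z = x
    · exact Or.inl hzx
    right
    have hzC : (⟨z, hzx⟩ : ({x}ᶜ : Set M)) ∈ (C n)ᶜ := fun h => hz ⟨_, h, rfl⟩
    by_cases h : ∃ j, j ≠ i₀ ∧ (⟨z, hzx⟩ : ({x}ᶜ : Set M)) ∈ (e j).1 n
    · obtain ⟨j, -, hj⟩ := h
      exact Set.mem_iUnion.2 ⟨j, _, hsub j hj, rfl⟩
    · push Not at h
      exact Set.mem_iUnion.2 ⟨i₀, ⟨z, hzx⟩, ⟨hzC, fun _ => h, fun h => absurd rfl h⟩, rfl⟩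
  · exact fun i => ⟨Set.image_mono (hsub i), ((e i).isPreconnected n).image _
      continuous_subtype_val.continuousOn, mem_closure_image_end hC (e i) n⟩

end Valence

theorem IsExhaustion.exists_finite_components {X : Type*} [TopologicalSpace X] [T2Space X]
    [LocallyConnectedSpace X] [PreconnectedSpace X] {C : ℕ → Set X} (hC : IsExhaustion C) (n : ℕ) :
    ∃ T : Set X, T.Finite ∧ T ⊆ (C n)ᶜ ∧
      ∀ z ∉ C (n + 1), ∃ t ∈ T, z ∈ connectedComponentIn (C n)ᶜ t := by
  have hopen : IsOpen (C n)ᶜ := (hC.isCompact n).isClosed.isOpen_compl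
  have hfr : frontier (C (n + 1)) ⊆ (C n)ᶜ := fun z hz h => hz.2 (hC.subset_interior n h)
  have hfrC : IsCompact (frontier (C (n + 1))) :=
    (hC.isCompact (n + 1)).of_isClosed_subset isClosed_frontier
      (hC.isCompact (n + 1)).isClosed.frontier_subset
  obtain ⟨T, hT, hcov⟩ := hfrC.elim_nhds_subcover (fun t => connectedComponentIn (C n)ᶜ t)
    fun t ht => connectedComponentIn_mem_nhds (hopen.mem_nhds (hfr ht))
  by_cases hne : (C (n + 1)).Nonempty
  · refine ⟨T, T.finite_toSet, fun t ht => hfr (hT t ht), fun z hz => ?_⟩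
    have hzC : z ∈ (C n)ᶜ := fun h => hz (hC.mono n.le_succ h)
    set Q := connectedComponentIn (C n)ᶜ z
    have hQo : IsOpen Q := hopen.connectedComponentIn
    have hzQ : z ∈ Q := mem_connectedComponentIn hzC
    have hQ : (Q ∩ C (n + 1)).Nonempty := by
      by_contra hempty
      have hdisj : Disjoint Q (C (n + 1)) := Set.disjoint_iff_inter_eq_empty.2
        (Set.not_nonempty_iff_eq_empty.1 hempty)
      have hQcl : IsClosed Q := by
        refine isClosed_of_closure_subset fun w hw => ?_
        have hwC : w ∈ (C n)ᶜ := fun h => by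
          have h1 : w ∈ interior (C (n + 1)) := hC.subset_interior n h
          obtain ⟨v, hv, hv'⟩ := mem_closure_iff.1 hw _ isOpen_interior h1
          exact Set.disjoint_left.1 hdisj hv' (interior_subset hv)
        obtain ⟨v, hv, hv'⟩ := mem_closure_iff_nhds.1 hw _
          (connectedComponentIn_mem_nhds (hopen.mem_nhds hwC))
        have : Q = connectedComponentIn (C n)ᶜ w :=
          (connectedComponentIn_eq hv').trans (connectedComponentIn_eq hv).symm
        rw [this]
        exact mem_connectedComponentIn hwC
      have huniv : Q = Set.univ := IsClopen.eq_univ ⟨hQcl, hQo⟩ ⟨z, hzQ⟩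
      obtain ⟨w, hw⟩ := hne
      exact hempty ⟨w, huniv ▸ Set.mem_univ w, hw⟩
    obtain ⟨w, hwQ, hw⟩ : (Q ∩ frontier (C (n + 1))).Nonempty := by
      by_contra hempty
      have hcl := (hC.isCompact (n + 1)).isClosed
      have hcover : Q ⊆ interior (C (n + 1)) ∪ (C (n + 1))ᶜ := by
        intro w hw
        by_contra h
        simp only [Set.mem_union, Set.mem_compl_iff, not_or, not_not] at h
        exact hempty ⟨w, hw, subset_closure h.2, h.1⟩
      obtain ⟨w, hwQ, hw⟩ := hQ
      exact hz (interior_subset (isPreconnected_connectedComponentIn.subset_left_of_subset_union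
        isOpen_interior hcl.isOpen_compl (disjoint_compl_right.mono_left interior_subset) hcover
        ⟨w, hwQ, (hcover hwQ).resolve_right fun h => h hw⟩ hzQ))
    obtain ⟨t, ht, hwt⟩ := Set.mem_iUnion₂.1 (hcov hw)
    refine ⟨t, ht, ?_⟩
    rw [connectedComponentIn_eq hwt, ← connectedComponentIn_eq hwQ]
    exact hzQ
  · have hCn : C n = ∅ := Set.subset_eq_empty (hC.mono n.le_succ)
      (Set.not_nonempty_iff_eq_empty.1 hne)
    rcases isEmpty_or_nonempty X with hX | ⟨⟨t⟩⟩
    · exact ⟨∅, Set.finite_empty, Set.empty_subset _, fun z => isEmptyElim z⟩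
    · refine ⟨{t}, Set.finite_singleton t, by simp [hCn], fun z _ => ⟨t, rfl, ?_⟩⟩
      rw [hCn, Set.compl_empty, connectedComponentIn_univ,
        PreconnectedSpace.connectedComponent_eq_univ]
      trivial

/-- A sequence leaving every compact set of an exhaustion determines an end whose terms all meet
the sequence in arbitrarily late terms. -/
theorem IsExhaustion.exists_end_of_seq {X : Type*} [TopologicalSpace X] [T2Space X]
    [LocallyConnectedSpace X] [PreconnectedSpace X] {C : ℕ → Set X} (hC : IsExhaustion C)
    {z : ℕ → X} (hz : ∀ j, z j ∉ C j) : ∃ E : EndsSpace C, ∀ n, ∃ j, z j ∈ E.1 n := by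
  have key : ∀ n, ∃ t ∈ (C n)ᶜ,
      ∀ᶠ j in (hyperfilter ℕ : Filter ℕ), z j ∈ connectedComponentIn (C n)ᶜ t := by
    intro n
    obtain ⟨T, hfin, hT, hcov⟩ := hC.exists_finite_components n
    have : ∀ᶠ j in (hyperfilter ℕ : Filter ℕ), ∃ t ∈ T, z j ∈ connectedComponentIn (C n)ᶜ t := by
      have hge : ∀ᶠ j in (hyperfilter ℕ : Filter ℕ), n + 1 ≤ j :=
        Nat.hyperfilter_le_atTop (eventually_ge_atTop (n + 1))
      filter_upwards [hge] with j hj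
      exact hcov _ fun h => hz j (hC.mono hj h)
    obtain ⟨t, ht, h⟩ := (Ultrafilter.eventually_exists_mem_iff hfin).1 this
    exact ⟨t, hT ht, h⟩
  choose t ht hev using key
  refine ⟨⟨fun n => connectedComponentIn (C n)ᶜ (t n), fun n => ⟨t n, ht n, rfl⟩, fun n => ?_⟩,
    fun n => (hev n).exists⟩
  obtain ⟨j, h1, h2⟩ := ((hev n).and (hev (n + 1))).exists
  change connectedComponentIn (C (n + 1))ᶜ (t (n + 1)) ⊆ connectedComponentIn (C n)ᶜ (t n)
  rw [connectedComponentIn_eq h1, connectedComponentIn_eq h2]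
  exact connectedComponentIn_mono _ (Set.compl_subset_compl.2 (hC.mono n.le_succ))

section Valence

variable {M : Type*} [MetricSpace M] [CompactSpace M] [LocallyConnectedSpace M] {x : M}
  {C : ℕ → Set (({x}ᶜ : Set M))}

theorem IsLocalSplitting.exists_injective {ι : Type*} {U : ι → Set M}
    (hU : IsLocalSplitting x U) (hx : IsPreconnected ({x}ᶜ : Set M)) (hC : IsExhaustion C) :
    ∃ e : ι → EndsSpace C, Function.Injective e := by
  have hlc : LocallyConnectedSpace ({x}ᶜ : Set M) := isOpen_compl_singleton.locallyConnectedSpace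
  have hpc : PreconnectedSpace ({x}ᶜ : Set M) := isPreconnected_iff_preconnectedSpace.1 hx
  obtain ⟨N, hN⟩ : ∃ N, Subtype.val '' (C N)ᶜ ⊆ ⋃ i, U i := by
    obtain ⟨O, hOsub, hO, hxO⟩ := mem_nhds_iff.1 hU.insert_mem_nhds
    have hK : IsCompact ((Subtype.val : ({x}ᶜ : Set M) → M) ⁻¹' Oᶜ) := by
      rw [Topology.IsEmbedding.subtypeVal.isCompact_iff, Subtype.image_preimage_coe,
        Set.inter_eq_right.2 (by rintro z hz rfl; exact hz hxO)]
      exact hO.isClosed_compl.isCompact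
    obtain ⟨N, hN⟩ := hC.exists_superset hK
    refine ⟨N, ?_⟩
    rintro _ ⟨z, hz, rfl⟩
    have : (z : M) ∈ O := by
      by_contra h
      exact hz (hN h)
    exact (hOsub this).resolve_left z.2
  have hex : ∀ i, ∃ E : EndsSpace C, Subtype.val '' E.1 N ⊆ U i := by
    intro i
    have hseq : ∀ j, ∃ z : ({x}ᶜ : Set M), z ∉ C j ∧ (z : M) ∈ U i := by
      intro j
      have hK : IsCompact (Subtype.val '' C j) := (hC.isCompact j).image continuous_subtype_val
      have hx : (Subtype.val '' C j)ᶜ ∈ 𝓝 x := by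
        refine hK.isClosed.isOpen_compl.mem_nhds ?_
        rintro ⟨z, -, hz⟩
        exact z.2 hz
      obtain ⟨z, hz, hzU⟩ := mem_closure_iff_nhds.1 (hU.mem_closure i) _ hx
      have hzx : z ≠ x := fun h => hU.notMem i (h ▸ hzU)
      exact ⟨⟨z, hzx⟩, fun h => hz ⟨_, h, rfl⟩, hzU⟩
    choose z hz hzU using hseq
    obtain ⟨E, hE⟩ := hC.exists_end_of_seq hz
    refine ⟨E, ?_⟩
    obtain ⟨i', hi'⟩ := ((E.isPreconnected N).image _
      continuous_subtype_val.continuousOn).exists_subset_of_subset_iUnion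
      ((E.nonempty N).image _) hU.isOpen hU.pairwise_disjoint
      ((Set.image_mono (E.subset_compl N)).trans hN)
    obtain ⟨j, hj⟩ := hE N
    rwa [eq_of_mem_of_pairwise_disjoint hU.pairwise_disjoint (hzU j) (hi' ⟨_, hj, rfl⟩)]
  choose e he using hex
  refine ⟨e, fun i j hij => ?_⟩
  obtain ⟨z, hz⟩ := (e i).nonempty N
  exact eq_of_mem_of_pairwise_disjoint hU.pairwise_disjoint (he i ⟨z, hz, rfl⟩)
    (he j ⟨z, hij ▸ hz, rfl⟩)

end Valence

theorem Cardinal.exists_injective_fin_iff {α : Type*} {n : ℕ} :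
    (∃ e : Fin n → α, Function.Injective e) ↔ (n : Cardinal) ≤ Cardinal.mk α := by
  have h : (n : Cardinal) ≤ Cardinal.mk α ↔ Nonempty (Fin n ↪ α) := by
    rw [← Cardinal.lift_mk_le', Cardinal.lift_mk_fin, Cardinal.lift_uzero]
  rw [h]
  exact ⟨fun ⟨e, he⟩ => ⟨⟨e, he⟩⟩, fun ⟨e⟩ => ⟨e, e.injective⟩⟩

/-- At a point that is not a global cut point, valence two means that there is a local splitting
into two pieces, but none into three. -/
theorem valenceEq_two_iff {M : Type u} [MetricSpace M] [CompactSpace M] [LocallyConnectedSpace M]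
    {x : M} (hx : IsPreconnected ({x}ᶜ : Set M)) :
    valenceEq x 2 ↔ (∃ U : Fin 2 → Set M, IsLocalSplitting x U) ∧
      ∀ U : Fin 3 → Set M, ¬ IsLocalSplitting x U := by
  constructor
  · intro h
    obtain ⟨C, hC⟩ := exists_isExhaustion_compl_singleton x
    have hcard := h C hC
    constructor
    · obtain ⟨e, he⟩ := (Cardinal.exists_injective_fin_iff (α := EndsSpace C) (n := 2)).2
        (by rw [hcard]; norm_num)
      obtain ⟨U, -, hU, -⟩ := exists_isLocalSplitting_of_injective hC he
      exact ⟨U, hU⟩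
    · intro U hU
      have := Cardinal.exists_injective_fin_iff.1 (hU.exists_injective hx hC)
      rw [hcard] at this
      norm_num at this
  · rintro ⟨⟨U, hU⟩, h3⟩ C hC
    apply le_antisymm
    · by_contra hlt
      have h : ((3 : ℕ) : Cardinal) ≤ Cardinal.mk (EndsSpace C) := by
        have := Cardinal.add_one_le_of_lt (not_le.1 hlt)
        rwa [two_add_one_eq_three] at this
      obtain ⟨e, he⟩ := Cardinal.exists_injective_fin_iff.2 h
      obtain ⟨U, -, hU, -⟩ := exists_isLocalSplitting_of_injective hC he
      exact h3 U hU
    · have := Cardinal.exists_injective_fin_iff.1 (hU.exists_injective hx hC)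
      exact_mod_cast this

/-- A clopen nonempty piece of `M ∖ {x, y}` accumulates at `x` as soon as `y` is not a global cut
point. -/
theorem mem_closure_image_of_isClopen {M : Type*} [TopologicalSpace M] [T1Space M] {x y : M}
    (hxy : x ≠ y) (hy : IsPreconnected ({y}ᶜ : Set M)) {s : Set (({x, y}ᶜ : Set M))}
    (hs : IsClopen s) (hne : s.Nonempty) : x ∈ closure (Subtype.val '' s) := by
  by_contra hx
  have hopen : IsOpen ({x, y}ᶜ : Set M) := (Set.toFinite _).isClosed.isOpen_compl
  have ho : IsOpen (Subtype.val '' s) := hopen.isOpenEmbedding_subtypeVal.isOpenMap _ hs.isOpen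
  have hcover : ({y}ᶜ : Set M) ⊆ Subtype.val '' s ∪ (closure (Subtype.val '' s))ᶜ := by
    intro z hz
    by_cases hzc : z ∈ closure (Subtype.val '' s)
    · left
      have hzx : z ≠ x := fun h => hx (h ▸ hzc)
      have hz' : z ∈ ({x, y}ᶜ : Set M) := by
        rintro (h | h)
        exacts [hzx h, hz h]
      refine ⟨⟨z, hz'⟩, ?_, rfl⟩
      rw [← hs.isClosed.closure_eq, closure_subtype]
      exact hzc
    · exact Or.inr hzc
  obtain ⟨w, hw⟩ := hne
  exact (hy.subset_left_of_subset_union ho isClosed_closure.isOpen_compl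
    (disjoint_compl_right.mono_left subset_closure) hcover
    ⟨w, fun h => w.2 (Or.inr h), w, hw, rfl⟩ |>.trans subset_closure) hxy |> hx

/-- If `{x, y}` separates `M`, the point `y` is not a global cut point and there is no local
splitting into three pieces at `x`, then `M ∖ {x, y}` has exactly two components. -/
theorem numComplementaryComponents_eq_two {M : Type u} [TopologicalSpace M] [T1Space M]
    [LocallyConnectedSpace M] {x y : M} (hxy : x ≠ y) (hy : IsPreconnected ({y}ᶜ : Set M))
    (h3 : ∀ U : Fin 3 → Set M, ¬ IsLocalSplitting x U)
    (hsep : ¬ IsPreconnected ({x, y}ᶜ : Set M)) : numComplementaryComponents M x y = 2 := by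
  have hopen : IsOpen ({x, y}ᶜ : Set M) := (Set.toFinite _).isClosed.isOpen_compl
  have hlc : LocallyConnectedSpace ({x, y}ᶜ : Set M) := hopen.locallyConnectedSpace
  rw [numComplementaryComponents, Cardinal.mk_eq_two_iff]
  obtain ⟨a, b, hab⟩ : ∃ a b : ConnectedComponents (({x, y}ᶜ : Set M)), a ≠ b := by
    by_contra! h
    apply hsep
    rw [isPreconnected_iff_preconnectedSpace, preconnectedSpace_iff_connectedComponent]
    intro z
    refine Set.eq_univ_of_forall fun w => ?_
    rw [← ConnectedComponents.coe_eq_coe']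
    exact h _ _
  refine ⟨a, b, hab, ?_⟩
  by_contra hne
  obtain ⟨c, hc⟩ := (Set.ne_univ_iff_exists_notMem _).1 hne
  let s : Fin 3 → Set (ConnectedComponents (({x, y}ᶜ : Set M))) := ![{a}, {b}, {a, b}ᶜ]
  let U : Fin 3 → Set M := fun i =>
    Subtype.val '' ((fun z : ({x, y}ᶜ : Set M) =>
      (z : ConnectedComponents (({x, y}ᶜ : Set M)))) ⁻¹' s i)
  have hcl : ∀ i, IsClopen ((fun z : ({x, y}ᶜ : Set M) =>
      (z : ConnectedComponents (({x, y}ᶜ : Set M)))) ⁻¹' s i) :=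
    fun i => (isClopen_discrete _).preimage ConnectedComponents.continuous_coe
  have hsne : ∀ i, (s i).Nonempty := by
    intro i
    fin_cases i
    exacts [⟨a, rfl⟩, ⟨b, rfl⟩, ⟨c, hc⟩]
  have hsd : Pairwise (Function.onFun Disjoint s) := by
    intro i j hij
    fin_cases i <;> fin_cases j <;> (simp_all [Function.onFun, s]; try grind)
  have hsu : ∀ z, ∃ i, z ∈ s i := by
    intro z
    by_cases hza : z = a
    · exact ⟨0, hza⟩
    by_cases hzb : z = b
    · exact ⟨1, hzb⟩
    · exact ⟨2, by rintro (h | h); exacts [hza h, hzb h]⟩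
  refine h3 U ⟨fun i => hopen.isOpenEmbedding_subtypeVal.isOpenMap _ (hcl i).isOpen, ?_, ?_, ?_, ?_⟩
  · intro i j hij
    exact (Set.disjoint_image_iff Subtype.val_injective).2 ((hsd hij).preimage _)
  · rintro i ⟨z, -, hz⟩
    exact z.2 (Or.inl hz)
  · intro i
    exact mem_closure_image_of_isClopen hxy hy (hcl i)
      ((hsne i).preimage ConnectedComponents.surjective_coe)
  · have : ({y}ᶜ : Set M) ∈ 𝓝 x := isOpen_compl_singleton.mem_nhds hxy
    filter_upwards [this] with z hz
    by_cases hzx : z = x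
    · exact Or.inl hzx
    right
    have hz' : z ∈ ({x, y}ᶜ : Set M) := by
      rintro (h | h)
      exacts [hzx h, hz h]
    obtain ⟨i, hi⟩ := hsu ((⟨z, hz'⟩ : ({x, y}ᶜ : Set M)) : ConnectedComponents _)
    exact Set.mem_iUnion.2 ⟨i, ⟨z, hz'⟩, hi, rfl⟩

section Action

variable {G : Type*} {M : Type u} [Group G] [MulAction G M]

theorem IsLocalSplitting.smul [TopologicalSpace M] [ContinuousConstSMul G M] {ι : Type*} {x : M}
    {U : ι → Set M} (hU : IsLocalSplitting x U) (g : G) :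
    IsLocalSplitting (g • x) (fun i => g • U i) where
  isOpen i := (hU.isOpen i).smul g
  pairwise_disjoint i j hij := Set.disjoint_smul_set.2 (hU.pairwise_disjoint hij)
  notMem i h := hU.notMem i (Set.smul_mem_smul_set_iff.1 h)
  mem_closure i := by
    rw [closure_smul]
    exact Set.smul_mem_smul_set (hU.mem_closure i)
  insert_mem_nhds := by
    have := (smul_mem_nhds_smul_iff g).2 hU.insert_mem_nhds
    rwa [Set.smul_set_insert, Set.smul_set_iUnion] at this

theorem IsLocalSplitting.of_smul [TopologicalSpace M] [ContinuousConstSMul G M] {ι : Type*} {x : M}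
    {g : G} {U : ι → Set M} (hU : IsLocalSplitting (g • x) U) :
    IsLocalSplitting x (fun i => g⁻¹ • U i) := by
  simpa using hU.smul g⁻¹

theorem isPreconnected_compl_smul_singleton [TopologicalSpace M] [ContinuousConstSMul G M] {x : M}
    (hx : IsPreconnected ({x}ᶜ : Set M)) (g : G) : IsPreconnected ({g • x}ᶜ : Set M) := by
  rw [← Set.smul_set_singleton, ← Set.smul_set_compl]
  exact hx.image _ (continuous_const_smul g).continuousOn

theorem IsConicalLimitPoint.smul [TopologicalSpace M] {x : M} (hx : IsConicalLimitPoint G x)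
    (h : G) : IsConicalLimitPoint G (h • x) := by
  obtain ⟨g, α, β, hαβ, h1, h2⟩ := hx
  refine ⟨fun n => g n * h⁻¹, α, β, hαβ, by simpa [mul_smul] using h1, fun y hy => ?_⟩
  have : h⁻¹ • y ≠ x := fun e => hy (by rw [← e, smul_inv_smul])
  simpa [mul_smul] using h2 _ this

theorem smul_mem_Mstar2 [MetricSpace M] [CompactSpace M] [LocallyConnectedSpace M]
    [ContinuousConstSMul G M] {x : M} (hx : x ∈ Mstar2 G M) (g : G) : g • x ∈ Mstar2 G M := by
  obtain ⟨h1, h2, h3⟩ := hx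
  have h2' : IsPreconnected ({x}ᶜ : Set M) := not_not.1 h2
  obtain ⟨⟨U, hU⟩, hno⟩ := (valenceEq_two_iff h2').1 h3
  have hg := isPreconnected_compl_smul_singleton h2' g
  exact ⟨h1.smul g, not_not.2 hg,
    (valenceEq_two_iff hg).2 ⟨⟨_, hU.smul g⟩, fun V hV => hno _ hV.of_smul⟩⟩

theorem TendstoLocallyUniformlyAway.tendsto [TopologicalSpace M] {g : ℕ → G} {α β y : M}
    (h : TendstoLocallyUniformlyAway g α β) (hy : y ≠ β) :
    Tendsto (fun n => g n • y) atTop (𝓝 α) := by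
  rw [tendsto_nhds]
  intro U hU hαU
  obtain ⟨N, hN⟩ := h {y} isCompact_singleton (by simpa using hy.symm) U hU hαU
  filter_upwards [eventually_gt_atTop N] with n hn
  exact hN n hn (Set.smul_mem_smul_set rfl)

theorem TendstoLocallyUniformlyAway.eventually_subset [TopologicalSpace M] {g : ℕ → G} {α β : M}
    (h : TendstoLocallyUniformlyAway g α β) {K : Set M} (hK : IsCompact K) (hβ : β ∉ K)
    {U : Set M} (hU : U ∈ 𝓝 α) : ∀ᶠ n in atTop, g n • K ⊆ U := by
  obtain ⟨O, hOU, hO, hαO⟩ := mem_nhds_iff.1 hU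
  obtain ⟨N, hN⟩ := h K hK (Set.subset_compl_singleton_iff.2 hβ) O hO hαO
  filter_upwards [eventually_gt_atTop N] with n hn
  exact (hN n hn).trans hOU

/-- Off a neighbourhood of the attracting point and the image of the repelling point, the images
of a local splitting eventually cover. -/
theorem TendstoLocallyUniformlyAway.eventually_mem_iUnion_smul [TopologicalSpace M]
    [CompactSpace M] {ι : Type*}
    {g : ℕ → G} {x β : M} (hg : TendstoLocallyUniformlyAway g β x) {U : ι → Set M}
    (hU : IsLocalSplitting x U) {N : Set M} (hN : N ∈ 𝓝 β) :
    ∀ᶠ n in atTop, ∀ z, z ∉ N → z ≠ g n • x → ∃ i, z ∈ g n • U i := by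
  obtain ⟨O, hOsub, hO, hxO⟩ := mem_nhds_iff.1 hU.insert_mem_nhds
  have hK : IsCompact Oᶜ := hO.isClosed_compl.isCompact
  filter_upwards [hg.eventually_subset hK (fun h => h hxO) hN] with n hn z hzN hzx
  have hzO : (g n)⁻¹ • z ∈ O := by
    by_contra h
    exact hzN (hn (Set.mem_smul_set_iff_inv_smul_mem.2 h))
  rcases hOsub hzO with h | h
  · exact absurd (by rw [← h, smul_inv_smul]) hzx
  · obtain ⟨i, hi⟩ := Set.mem_iUnion.1 h
    exact ⟨i, Set.mem_smul_set_iff_inv_smul_mem.2 hi⟩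

theorem exists_ball_isPreconnected_nhds [MetricSpace M] [LocallyConnectedSpace M] (z : M) {r : ℝ}
    (hr : 0 < r) : ∃ V : Set M, IsOpen V ∧ z ∈ V ∧ IsPreconnected V ∧ V ⊆ Metric.ball z r :=
  ⟨connectedComponentIn (Metric.ball z r) z, Metric.isOpen_ball.connectedComponentIn,
    mem_connectedComponentIn (Metric.mem_ball_self hr), isPreconnected_connectedComponentIn,
    connectedComponentIn_subset _ _⟩

/-- Two distinct points far along a conical sequence of translates of a local cut point form a
separating pair. -/
theorem exists_not_isPreconnected_compl_pair [MetricSpace M] [CompactSpace M]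
    [LocallyConnectedSpace M] [ContinuousConstSMul G M] {ι : Type*} [Finite ι] [Nontrivial ι]
    {g : ℕ → G} {x α β : M} (hαβ : α ≠ β) (hx : Tendsto (fun n => g n • x) atTop (𝓝 α))
    (hne : ∀ᶠ n in atTop, g n • x ≠ α) (hg : TendstoLocallyUniformlyAway g β x)
    {U : ι → Set M} (hU : IsLocalSplitting x U) :
    ∃ n m, g n • x ≠ g m • x ∧ ¬ IsPreconnected ({g n • x, g m • x}ᶜ : Set M) := by
  obtain ⟨r, hr, hrd⟩ : ∃ r > 0, 3 * r = dist α β :=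
    ⟨dist α β / 3, div_pos (dist_pos.2 hαβ) three_pos, by ring⟩
  have hUd : ∀ n, Pairwise (Function.onFun Disjoint fun i => g n • U i) :=
    fun n => (hU.smul (g n)).pairwise_disjoint
  have hUo : ∀ n i, IsOpen (g n • U i) := fun n => (hU.smul (g n)).isOpen
  choose V hVo hzV hVc hVb using fun z : M => exists_ball_isPreconnected_nhds z (half_pos hr)
  set S : Set M := (Metric.ball α r ∪ Metric.ball β r)ᶜ with hS
  have hScomp : IsCompact S :=
    (Metric.isOpen_ball.union Metric.isOpen_ball).isClosed_compl.isCompact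
  obtain ⟨t, htS, hcov⟩ := hScomp.elim_nhds_subcover V fun z _ => (hVo z).mem_nhds (hzV z)
  have hlarge : ∀ᶠ n in atTop, g n • x ≠ α ∧ dist (g n • x) α < r / 2 ∧
      ∀ z, z ∉ Metric.ball β (r / 2) → z ≠ g n • x → ∃ i, z ∈ g n • U i :=
    hne.and ((Metric.tendsto_nhds.1 hx _ (half_pos hr)).and
      (hg.eventually_mem_iUnion_smul hU (Metric.ball_mem_nhds β (half_pos hr))))
  obtain ⟨N, hN⟩ := eventually_atTop.1 hlarge
  have hpat : ∀ n ≥ N, ∃ p : t → ι, ∀ v : t, V v ⊆ g n • U (p v) := by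
    intro n hn
    obtain ⟨-, h1, h2⟩ := hN n hn
    refine ⟨_, fun v => Classical.choose_spec ((hVc v).exists_subset_of_subset_iUnion
      ⟨_, hzV v⟩ (hUo n) (hUd n) fun w hw => Set.mem_iUnion.2 (h2 w ?_ ?_))⟩
    · intro hwβ
      have hv := htS v v.2
      have h3 := hVb v hw
      simp only [hS, Set.mem_compl_iff, Set.mem_union, not_or, Metric.mem_ball, not_lt] at hv h3 hwβ
      linarith [dist_triangle_left (v : M) β w, hv.2]
    · rintro rfl
      have hv := htS v v.2
      have h3 := hVb v hw
      simp only [hS, Set.mem_compl_iff, Set.mem_union, not_or, Metric.mem_ball, not_lt] at hv h3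
      linarith [dist_triangle_left (v : M) α (g n • x), hv.1]
  have hinf : ((fun n => g n • x) '' Set.Ici N).Infinite := by
    intro hfin
    have : α ∈ (fun n => g n • x) '' Set.Ici N := by
      rw [← hfin.isClosed.closure_eq]
      refine mem_closure_of_tendsto hx ?_
      filter_upwards [eventually_ge_atTop N] with n hn
      exact ⟨n, hn, rfl⟩
    obtain ⟨n, hn, h⟩ := this
    exact (hN n hn).1 h
  have := hinf.to_subtype
  have hchoice : ∀ w : ((fun n => g n • x) '' Set.Ici N), ∃ n ≥ N, g n • x = w := by
    rintro ⟨_, n, hn, rfl⟩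
    exact ⟨n, hn, rfl⟩
  choose k hkN hk using hchoice
  choose p hp using hpat
  obtain ⟨w, w', hww', hpw⟩ := Finite.exists_ne_map_eq_of_infinite fun w => p (k w) (hkN w)
  obtain ⟨q, hp1, hp2⟩ : ∃ q : t → ι, (∀ v : t, V v ⊆ g (k w) • U (q v)) ∧
      ∀ v : t, V v ⊆ g (k w') • U (q v) := by
    refine ⟨p (k w) (hkN w), hp _ _, ?_⟩
    have := hp (k w') (hkN w')
    simp only [← hpw] at this
    exact this
  clear hpw
  obtain ⟨-, hn1, hn2⟩ := hN (k w) (hkN w)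
  obtain ⟨-, hm1, hm2⟩ := hN (k w') (hkN w')
  have hnm : g (k w) • x ≠ g (k w') • x := by
    rw [hk, hk]
    exact fun h => hww' (Subtype.ext h)
  generalize k w = n at *
  generalize k w' = m at *
  refine ⟨n, m, hnm, fun hconn => ?_⟩
  have hballs : Disjoint (Metric.ball α r) (Metric.ball β r) := by
    refine Metric.ball_disjoint_ball (by linarith)
  have hxn : g n • x ∈ Metric.ball α r := Metric.mem_ball.2 (by linarith)
  have hxm : g m • x ∈ Metric.ball α r := Metric.mem_ball.2 (by linarith)
  set R : Set M := {z | z ∈ Metric.ball α r ∧ ∃ i j, i ≠ j ∧ z ∈ g n • U i ∧ z ∈ g m • U j} with hR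
  have hRo : IsOpen R := by
    have : R = Metric.ball α r ∩ ⋃ (i) (j) (_ : i ≠ j), (g n • U i ∩ g m • U j) := by
      ext z
      simp only [hR, Set.mem_ofPred_eq, Set.mem_inter_iff, Set.mem_iUnion, exists_prop]
    rw [this]
    exact Metric.isOpen_ball.inter (isOpen_iUnion fun i => isOpen_iUnion fun j =>
      isOpen_iUnion fun _ => (hUo n i).inter (hUo m j))
  have hRβ : Disjoint (closure R) (Metric.ball β r) :=
    (hballs.mono_left fun z hz => hz.1).closure_left Metric.isOpen_ball
  have hcl : ∀ z ∈ closure R, z ≠ g n • x → z ≠ g m • x → z ∈ R := by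
    intro z hz hzn hzm
    have hzβ : z ∉ Metric.ball β r := Set.disjoint_left.1 hRβ hz
    have hzβ' : z ∉ Metric.ball β (r / 2) :=
      fun h => hzβ (Metric.ball_subset_ball (by linarith) h)
    obtain ⟨i, hi⟩ := hn2 z hzβ' hzn
    obtain ⟨j, hj⟩ := hm2 z hzβ' hzm
    have hij : i ≠ j := by
      rintro rfl
      obtain ⟨w, ⟨hw1, hw2⟩, -, i', j', hij, hi', hj'⟩ :=
        mem_closure_iff.1 hz _ ((hUo n i).inter (hUo m i)) ⟨hi, hj⟩
      exact hij ((eq_of_mem_of_pairwise_disjoint (hUd n) hi' hw1).trans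
        (eq_of_mem_of_pairwise_disjoint (hUd m) hw2 hj'))
    refine ⟨?_, i, j, hij, hi, hj⟩
    by_contra hzα
    obtain ⟨v, hv, hzv⟩ := Set.mem_iUnion₂.1 (hcov (show z ∈ S by
      rintro (h | h)
      exacts [hzα h, hzβ h]))
    exact hij ((eq_of_mem_of_pairwise_disjoint (hUd n) hi (hp1 ⟨v, hv⟩ hzv)).trans
      (eq_of_mem_of_pairwise_disjoint (hUd m) (hp2 ⟨v, hv⟩ hzv) hj))
  obtain ⟨z, hzR, hzn, hzm⟩ : ∃ z ∈ R, z ≠ g n • x ∧ z ≠ g m • x := by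
    have hmβ : g m • x ∉ Metric.ball β (r / 2) := fun h => Set.disjoint_left.1 hballs hxm
      (Metric.ball_subset_ball (by linarith) h)
    obtain ⟨i, hi⟩ := hn2 _ hmβ hnm.symm
    obtain ⟨j, hj⟩ := exists_ne i
    obtain ⟨z, ⟨hz1, hz2⟩, hz3⟩ := mem_closure_iff.1 ((hU.smul (g m)).mem_closure j) _
      ((hUo n i).inter Metric.isOpen_ball) ⟨hi, hxm⟩
    refine ⟨z, ⟨hz2, i, j, hj.symm, hz1, hz3⟩, ?_, ?_⟩
    · rintro rfl
      exact (hU.smul (g n)).notMem i hz1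
    · rintro rfl
      exact (hU.smul (g m)).notMem j hz3
  have hβ : β ∈ Metric.ball β r := Metric.mem_ball_self hr
  have hsub := hconn.subset_left_of_subset_union hRo isClosed_closure.isOpen_compl
    (Set.disjoint_left.2 fun w hw hw' => hw' (subset_closure hw)) (fun w hw => by
      by_cases h : w ∈ closure R
      · exact Or.inl (hcl w h (fun h => hw (Or.inl h)) (fun h => hw (Or.inr h)))
      · exact Or.inr h) ⟨z, by rintro (h | h); exacts [hzn h, hzm h], hzR⟩
  refine Set.disjoint_left.1 hballs (hsub (a := β) ?_).1 hβ
  rintro (h | h)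
  · exact Set.disjoint_left.1 hballs hxn (h ▸ hβ)
  · exact Set.disjoint_left.1 hballs hxm (h ▸ hβ)

/-- A sequence of translations fixing `x` and attracting everything else to `b` spreads a local
splitting at `x` with connected pieces over all of `M ∖ {x, b}`. -/
theorem exists_isLocalSplitting_iUnion_eq [MetricSpace M] [CompactSpace M]
    [LocallyConnectedSpace M] [ContinuousConstSMul G M] {ι : Type*} [Finite ι] {g : ℕ → G}
    {x b : M} (hbx : b ≠ x) (hfix : ∀ n, g n • x = x) (hg : TendstoLocallyUniformlyAway g b x)
    {U F : ι → Set M} (hU : IsLocalSplitting x U)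
    (hF : ∀ i, F i ⊆ U i ∧ IsPreconnected (F i) ∧ x ∈ closure (F i)) :
    ∃ A : ι → Set M, IsLocalSplitting b A ∧ ⋃ i, A i = {x, b}ᶜ := by
  have hUd : ∀ n, Pairwise (Function.onFun Disjoint fun i => g n • U i) :=
    fun n => (hU.smul (g n)).pairwise_disjoint
  have hUo : ∀ n i, IsOpen (g n • U i) := fun n => (hU.smul (g n)).isOpen
  set ω : Ultrafilter ℕ := hyperfilter ℕ
  have hω : (ω : Filter ℕ) ≤ atTop := Nat.hyperfilter_le_atTop
  have key : ∀ z, z ≠ x → z ≠ b → ∃ i, ∃ V : Set M, IsOpen V ∧ z ∈ V ∧ V ⊆ {x, b}ᶜ ∧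
      ∀ᶠ k in (ω : Filter ℕ), V ⊆ g k • U i := by
    intro z hzx hzb
    have hzx' := dist_pos.2 hzx
    have hzb' := half_pos (dist_pos.2 hzb)
    obtain ⟨V, hVo, hzV, hVc, hVb⟩ := exists_ball_isPreconnected_nhds z (lt_min hzx' hzb')
    have hVx : x ∉ V := fun h => by
      have := (Metric.mem_ball'.1 (hVb h)).trans_le (min_le_left _ _)
      exact lt_irrefl _ this
    have hVN : ∀ w ∈ V, w ∉ Metric.ball b (dist z b / 2) := fun w hw hwb => by
      have h1 := (Metric.mem_ball.1 (hVb hw)).trans_le (min_le_right _ _)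
      have h2 := Metric.mem_ball.1 hwb
      linarith [dist_triangle_left z b w]
    have hev : ∀ᶠ k in (ω : Filter ℕ), ∃ i, V ⊆ g k • U i := by
      refine hω ?_
      filter_upwards [hg.eventually_mem_iUnion_smul hU (Metric.ball_mem_nhds b hzb')] with k hk
      refine hVc.exists_subset_of_subset_iUnion ⟨z, hzV⟩ (hUo k) (hUd k) fun w hw =>
        Set.mem_iUnion.2 (hk w (hVN w hw) ?_)
      rw [hfix]
      rintro rfl
      exact hVx hw
    obtain ⟨i, hi⟩ := Ultrafilter.eventually_exists_iff.1 hev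
    refine ⟨i, V, hVo, hzV, ?_, hi⟩
    rintro w hw (h | h)
    · exact hVx (h ▸ hw)
    · exact hVN w hw (by rw [show w = b from h]; exact Metric.mem_ball_self hzb')
  set A : ι → Set M := fun i => {z | z ≠ x ∧ z ≠ b ∧ ∀ᶠ k in (ω : Filter ℕ), z ∈ g k • U i}
  have hAd : Pairwise (Function.onFun Disjoint A) := by
    intro i j hij
    refine Set.disjoint_left.2 fun z hi hj => ?_
    obtain ⟨k, h1, h2⟩ := (hi.2.2.and hj.2.2).exists
    exact hij (eq_of_mem_of_pairwise_disjoint (hUd k) h1 h2)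
  have hAun : ⋃ i, A i = {x, b}ᶜ := by
    ext z
    constructor
    · intro hz
      obtain ⟨i, h1, h2, -⟩ := Set.mem_iUnion.1 hz
      rintro (h | h)
      exacts [h1 h, h2 h]
    · intro hz
      have h1 : z ≠ x := fun h => hz (Or.inl h)
      have h2 : z ≠ b := fun h => hz (Or.inr h)
      obtain ⟨i, V, -, hzV, -, hV⟩ := key z h1 h2
      exact Set.mem_iUnion.2 ⟨i, h1, h2, hV.mono fun k hk => hk hzV⟩
  refine ⟨A, ⟨fun i => ?_, hAd, fun i h => h.2.1 rfl, fun i => ?_, ?_⟩, hAun⟩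
  · rw [isOpen_iff_mem_nhds]
    rintro z ⟨h1, h2, h3⟩
    obtain ⟨j, V, hVo, hzV, hVx, hV⟩ := key z h1 h2
    obtain ⟨k, hk1, hk2⟩ := (h3.and hV).exists
    obtain rfl := eq_of_mem_of_pairwise_disjoint (hUd k) hk1 (hk2 hzV)
    filter_upwards [hVo.mem_nhds hzV] with w hw
    exact ⟨fun h => hVx hw (Or.inl h), fun h => hVx hw (Or.inr h), hV.mono fun k hk => hk hw⟩
  · obtain ⟨hFU, hFc, hFx⟩ := hF i
    rw [Metric.mem_closure_iff]
    intro ε hε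
    set r := min (ε / 2) (dist x b / 2) with hr
    have hxb : 0 < dist x b := dist_pos.2 hbx.symm
    have hr0 : 0 < r := lt_min (half_pos hε) (half_pos hxb)
    have hrε : r < ε := (min_le_left _ _).trans_lt (half_lt_self hε)
    have hrx : r < dist x b := (min_le_right _ _).trans_lt (half_lt_self hxb)
    obtain ⟨f, hf⟩ := closure_nonempty_iff.1 ⟨x, hFx⟩
    have hfx : f ≠ x := fun h => hU.notMem i (h ▸ hFU hf)
    have hcross : ∀ᶠ k in (ω : Filter ℕ), ∃ w, w ∈ g k • F i ∧ dist w b = r := by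
      refine hω ?_
      filter_upwards [Metric.tendsto_nhds.1 (hg.tendsto hfx) r hr0] with k hk
      have hxk : x ∈ closure (g k • F i) := by
        rw [closure_smul]
        exact ⟨x, hFx, hfix k⟩
      obtain ⟨w, hw, hwF⟩ := mem_closure_iff.1 hxk {w | r < dist w b}
        (isOpen_lt continuous_const (continuous_id.dist continuous_const)) hrx
      obtain ⟨v, hv, hvr⟩ := (hFc.image _ (continuous_const_smul (g k)).continuousOn
        ).intermediate_value (Set.smul_mem_smul_set hf) hwF
        (continuous_id.dist (continuous_const (y := b))).continuousOn ⟨hk.le, le_of_lt hw⟩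
      exact ⟨v, hv, hvr⟩
    obtain ⟨w, hw⟩ := hcross.choice
    obtain ⟨z, hz⟩ : ∃ z, Tendsto w ω (𝓝 z) := ⟨_, (ω.map w).le_nhds_lim⟩
    have hzr : dist z b = r :=
      tendsto_nhds_unique (hz.dist tendsto_const_nhds)
        (tendsto_const_nhds.congr' (hw.mono fun k hk => hk.2.symm))
    have hzb : z ≠ b := by
      rintro rfl
      rw [dist_self] at hzr
      exact hr0.ne hzr
    have hzx : z ≠ x := by
      rintro rfl
      exact hrx.ne' hzr
    obtain ⟨j, V, hVo, hzV, hVx, hV⟩ := key z hzx hzb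
    obtain ⟨k, ⟨hk1, -⟩, hk2, hk3⟩ := (hw.and (hV.and (hz (hVo.mem_nhds hzV)))).exists
    obtain rfl := eq_of_mem_of_pairwise_disjoint (hUd k) (Set.smul_set_mono hFU hk1) (hk2 hk3)
    exact ⟨z, ⟨hzx, hzb, hV.mono fun k hk => hk hzV⟩, by rwa [dist_comm, hzr]⟩
  · rw [hAun]
    filter_upwards [isOpen_compl_singleton.mem_nhds hbx] with z hz
    by_cases hzb : z = b
    · exact Or.inl hzb
    · exact Or.inr (by rintro (h | h); exacts [hz h, hzb h])

theorem exists_strictMono_injective_of_finite_fibers {α : Type*} {g : ℕ → α}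
    (hg : ∀ a, {n | g n = a}.Finite) : ∃ φ : ℕ → ℕ, StrictMono φ ∧ Function.Injective (g ∘ φ) := by
  obtain ⟨φ, -, hφ⟩ := exists_seq_of_forall_finset_exists (fun _ : ℕ => True)
    (fun m n => m < n ∧ g m ≠ g n) (fun s _ => by
      have : ∀ᶠ n in atTop, ∀ m ∈ s, m < n ∧ g m ≠ g n := by
        rw [Finset.eventually_all]
        intro m _
        refine (eventually_gt_atTop m).and ?_
        have := (hg (g m)).eventually_cofinite_notMem
        rw [Nat.cofinite_eq_atTop] at this
        exact this.mono fun n hn h => hn h.symm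
      obtain ⟨n, hn⟩ := this.exists
      exact ⟨n, trivial, hn⟩)
  refine ⟨φ, fun m n h => (hφ m n h).1, fun m n h => ?_⟩
  rcases lt_trichotomy m n with h' | h' | h'
  · exact absurd h (hφ m n h').2
  · exact h'
  · exact absurd h.symm (hφ n m h').2

theorem IsConicalLimitPoint.exists_tendstoLocallyUniformlyAway [TopologicalSpace M] [T2Space M]
    [Infinite M] (hG : IsConvergenceAction G M) {x : M} (hx : IsConicalLimitPoint G x) :
    ∃ (g : ℕ → G) (α β : M), α ≠ β ∧ Tendsto (fun n => g n • x) atTop (𝓝 α) ∧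
      TendstoLocallyUniformlyAway g β x := by
  obtain ⟨g, α, β, hαβ, h1, h2⟩ := hx
  have hfib : ∀ a, {n | g n = a}.Finite := by
    intro a
    by_contra hinf
    have hfreq : ∃ᶠ n in atTop, g n = a := Nat.frequently_atTop_iff_infinite.2 hinf
    have hconst : ∀ y, y ≠ x → a • y = β := by
      intro y hy
      by_contra hne
      have := (h2 y hy).eventually (isOpen_compl_singleton.mem_nhds (Ne.symm hne))
      obtain ⟨n, hn, hn'⟩ := (hfreq.and_eventually this).exists
      exact hn' (by rw [hn]; rfl)
    obtain ⟨y, hy⟩ := Infinite.exists_notMem_finset {x}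
    obtain ⟨z, hz⟩ := (Set.toFinite {x, y}).exists_notMem
    have hyx : y ≠ x := by simpa using hy
    have hzx : z ≠ x := fun h => hz (Or.inl h)
    have hzy : z ≠ y := fun h => hz (Or.inr h)
    exact hzy (smul_left_cancel a ((hconst z hzx).trans (hconst y hyx).symm))
  obtain ⟨φ, hφ, hinj⟩ := exists_strictMono_injective_of_finite_fibers hfib
  obtain ⟨α', β', ψ, hψ, hconv, -⟩ := hG _ hinj
  have hsub : Tendsto (fun n => φ (ψ n)) atTop atTop := hφ.tendsto_atTop.comp hψ.tendsto_atTop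
  have hα' : α' = β := by
    obtain ⟨y, hy⟩ := (Set.toFinite {x, β'}).exists_notMem
    exact tendsto_nhds_unique (hconv.tendsto fun h => hy (Or.inr h))
      ((h2 y fun h => hy (Or.inl h)).comp hsub)
  have hβ' : β' = x := by
    by_contra hne
    have := tendsto_nhds_unique (hconv.tendsto (Ne.symm hne)) (h1.comp hsub)
    exact hαβ (this.symm.trans hα')
  subst hα' hβ'
  exact ⟨_, α, α', hαβ, h1.comp hsub, hconv⟩

/-- An element of a convergence group that fixes `x` and maps the complement of a neighbourhood of
`x` well inside itself has a fixed point attracting everything but `x`. -/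
theorem IsConvergenceAction.exists_attracting_point [TopologicalSpace M] [T2Space M]
    [ContinuousConstSMul G M] (hG : IsConvergenceAction G M) {h : G} {x p : M} (hx : h • x = x)
    {P Q : Set M} (hP : IsOpen P) (hxP : x ∈ P) (hQ : IsClosed Q) (hPQ : Disjoint P Q)
    (hpP : p ∉ P) (hpQ : p ∉ Q) (hmap : h • Pᶜ ⊆ Q) :
    ∃ b, b ≠ x ∧ ∃ g : ℕ → G, (∀ n, g n • x = x) ∧ (∀ n, g n • b = b) ∧
      TendstoLocallyUniformlyAway g b x ∧
      TendstoLocallyUniformlyAway (fun n => (g n)⁻¹) x b := by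
  have hpow : ∀ k : ℕ, ∀ z ∉ P, h ^ (k + 1) • z ∈ Q := by
    intro k
    induction k with
    | zero => exact fun z hz => by simpa using hmap (Set.smul_mem_smul_set hz)
    | succ k ih =>
      intro z hz
      rw [pow_succ', mul_smul]
      exact hmap (Set.smul_mem_smul_set fun h' => Set.disjoint_left.1 hPQ h' (ih z hz))
  have hinj : Function.Injective fun n : ℕ => h ^ n := by
    rw [injective_pow_iff_not_isOfFinOrder, isOfFinOrder_iff_pow_eq_one]
    rintro ⟨n, hn, h1⟩
    obtain ⟨k, rfl⟩ := Nat.exists_eq_succ_of_ne_zero hn.ne'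
    have := hpow k p hpP
    rw [← Nat.succ_eq_add_one, h1, one_smul] at this
    exact hpQ this
  have hxpow : ∀ n : ℕ, h ^ n • x = x := fun n => by
    induction n with
    | zero => simp
    | succ n ih => rw [pow_succ, mul_smul, hx, ih]
  obtain ⟨a, c, φ, hφ, hconv, hconv'⟩ := hG _ hinj
  have hlate : ∀ z ∉ P, ∀ᶠ n in atTop, h ^ φ n • z ∈ Q := by
    intro z hz
    filter_upwards [hφ.tendsto_atTop.eventually_ge_atTop 1] with n hn
    obtain ⟨k, hk⟩ := Nat.exists_eq_add_of_le' hn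
    rw [hk]
    exact hpow k z hz
  have hhp : h • p ∈ Q := hmap (Set.smul_mem_smul_set hpP)
  have hhpP : h • p ∉ P := fun h' => Set.disjoint_left.1 hPQ h' hhp
  have hc : c = x := by
    by_contra hne
    have ha : a = x := by
      refine tendsto_nhds_unique (hconv.tendsto (Ne.symm hne)) ?_
      simp only [hxpow]
      exact tendsto_const_nhds
    obtain ⟨z, hzP, hzc⟩ : ∃ z, z ∉ P ∧ z ≠ c := by
      by_cases hpc : p = c
      · exact ⟨h • p, hhpP, fun e => hpQ (hpc.trans e.symm ▸ hhp)⟩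
      · exact ⟨p, hpP, hpc⟩
    obtain ⟨n, hn1, hn2⟩ := ((hlate z hzP).and
      ((hconv.tendsto hzc).eventually (ha ▸ hP.mem_nhds hxP))).exists
    exact Set.disjoint_left.1 hPQ hn2 hn1
  subst hc
  have hpx : p ≠ c := fun e => hpP (e ▸ hxP)
  have hhpx : h • p ≠ c := fun e => hhpP (e ▸ hxP)
  have haQ : a ∈ Q := hQ.mem_of_tendsto (hconv.tendsto hpx) (hlate p hpP)
  have hha : h • a = a := by
    have h1 := (hconv.tendsto hpx).const_smul h
    refine tendsto_nhds_unique h1 ((hconv.tendsto hhpx).congr fun n => ?_)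
    rw [← mul_smul, ← mul_smul, ← pow_succ, pow_succ']
  refine ⟨a, fun e => Set.disjoint_left.1 hPQ hxP (e ▸ haQ), fun n => h ^ φ n,
    fun n => hxpow _, fun n => ?_, hconv, hconv'⟩
  change h ^ φ n • a = a
  generalize φ n = k
  induction k with
  | zero => simp
  | succ k ih => rw [pow_succ, mul_smul, hha, ih]

theorem exists_zoom_of_frequently_eq [MetricSpace M] [CompactSpace M] [ConnectedSpace M]
    [ContinuousConstSMul G M] (hG : IsConvergenceAction G M) {g : ℕ → G} {x α β : M}
    (hαβ : α ≠ β) (hg : TendstoLocallyUniformlyAway g β x)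
    (hfreq : ∃ᶠ n in atTop, g n • x = α) :
    ∃ b, b ≠ x ∧ ∃ f : ℕ → G, (∀ n, f n • x = x) ∧ (∀ n, f n • b = b) ∧
      TendstoLocallyUniformlyAway f b x ∧
      TendstoLocallyUniformlyAway (fun n => (f n)⁻¹) x b := by
  obtain ⟨n₀, hn₀⟩ := hfreq.exists
  set k := g n₀
  set γ := k⁻¹ • β with hγ
  have hxγ : x ≠ γ := by
    intro h
    apply hαβ
    rw [← hn₀, h, hγ, smul_inv_smul]
  obtain ⟨r, hr, hrd⟩ : ∃ r > 0, 3 * r = dist x γ :=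
    ⟨dist x γ / 3, div_pos (dist_pos.2 hxγ) three_pos, by ring⟩
  obtain ⟨p, -, hp⟩ := isPreconnected_univ.intermediate_value (Set.mem_univ x) (Set.mem_univ γ)
    (f := fun z => dist x z) (continuous_const.dist continuous_id).continuousOn
    (show 3 * r / 2 ∈ _ from ⟨by rw [dist_self]; positivity, by rw [← hrd]; linarith⟩)
  have hcomp : IsCompact (Metric.ball x r)ᶜ := Metric.isOpen_ball.isClosed_compl.isCompact
  have hnhds : k • Metric.closedBall γ r ∈ 𝓝 β := by
    have := (smul_mem_nhds_smul_iff k).2 (Metric.closedBall_mem_nhds γ hr)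
    rwa [hγ, smul_inv_smul] at this
  obtain ⟨n, hn, hsub⟩ := (hfreq.and_eventually (hg.eventually_subset hcomp
    (fun h => h (Metric.mem_ball_self hr)) hnhds)).exists
  refine hG.exists_attracting_point (h := k⁻¹ * g n) (p := p) (P := Metric.ball x r)
    (Q := Metric.closedBall γ r) ?_ Metric.isOpen_ball
    (Metric.mem_ball_self hr) Metric.isClosed_closedBall ?_ ?_ ?_ ?_
  · rw [mul_smul, hn, ← hn₀, inv_smul_smul]
  · rw [Set.disjoint_left]
    intro z hz hz'
    rw [Metric.mem_ball'] at hz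
    rw [Metric.mem_closedBall] at hz'
    linarith [dist_triangle x z γ]
  · rw [Metric.mem_ball', not_lt]
    simp only at hp
    linarith
  · rw [Metric.mem_closedBall, not_le]
    simp only at hp
    linarith [dist_triangle x p γ]
  · rw [mul_smul, Set.smul_set_subset_iff_subset_inv_smul_set, inv_inv]
    exact hsub

theorem mem_Mstar2_and_numComplementaryComponents_eq_two [MetricSpace M] [CompactSpace M]
    [LocallyConnectedSpace M] [ContinuousConstSMul G M] {x b : M} (hx : x ∈ Mstar2 G M)
    (hbx : b ≠ x) {g : ℕ → G} (hgx : ∀ n, g n • x = x) (hgb : ∀ n, g n • b = b)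
    (hg : TendstoLocallyUniformlyAway g b x)
    (hg' : TendstoLocallyUniformlyAway (fun n => (g n)⁻¹) x b) :
    b ∈ Mstar2 G M ∧ numComplementaryComponents M x b = 2 := by
  have hgb' : ∀ n, (g n)⁻¹ • b = b := fun n => inv_smul_eq_iff.2 (hgb n).symm
  have hcon : IsPreconnected ({x}ᶜ : Set M) := not_not.1 hx.2.1
  obtain ⟨⟨V, hV⟩, hno⟩ := (valenceEq_two_iff hcon).1 hx.2.2
  have hconb : IsPreconnected ({b}ᶜ : Set M) := by
    have hnhds : connectedComponentIn ({b}ᶜ : Set M) x ∈ 𝓝 x :=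
      connectedComponentIn_mem_nhds (isOpen_compl_singleton.mem_nhds hbx.symm)
    have hxW := mem_of_mem_nhds hnhds
    have hsub : ({b}ᶜ : Set M) ⊆ connectedComponentIn ({b}ᶜ : Set M) x := by
      intro z hz
      obtain ⟨n, hn⟩ := ((hg'.tendsto hz).eventually hnhds).exists
      have hpre : IsPreconnected (g n • connectedComponentIn ({b}ᶜ : Set M) x) :=
        isPreconnected_connectedComponentIn.image _ (continuous_const_smul (g n)).continuousOn
      refine hpre.subset_connectedComponentIn ⟨x, hxW, hgx n⟩ ?_
        (Set.mem_smul_set_iff_inv_smul_mem.2 hn)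
      rintro _ ⟨w, hw, rfl⟩ h
      refine connectedComponentIn_subset _ _ hw ?_
      have h : g n • w = b := h
      rw [← hgb n] at h
      exact smul_left_cancel _ h
    rw [hsub.antisymm (connectedComponentIn_subset _ _)]
    exact isPreconnected_connectedComponentIn
  obtain ⟨C, hC⟩ := exists_isExhaustion_compl_singleton x
  obtain ⟨e, he⟩ := hV.exists_injective hcon hC
  obtain ⟨U, F, hU, hF⟩ := exists_isLocalSplitting_of_injective hC he
  obtain ⟨A, hA, hAun⟩ := exists_isLocalSplitting_iUnion_eq hbx hgx hg hU hF
  have hsep : ¬ IsPreconnected ({x, b}ᶜ : Set M) := by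
    intro h
    have hAne : ∀ i, (A i).Nonempty := fun i => closure_nonempty_iff.1 ⟨b, hA.mem_closure i⟩
    have hsubA : ∀ i, A i ⊆ {x, b}ᶜ := fun i => hAun ▸ Set.subset_iUnion A i
    obtain ⟨i, hi⟩ := h.exists_subset_of_subset_iUnion ((hAne 0).mono (hsubA 0)) hA.isOpen
      hA.pairwise_disjoint hAun.ge
    obtain ⟨j, hj⟩ := exists_ne i
    obtain ⟨z, hz⟩ := hAne j
    exact hj (eq_of_mem_of_pairwise_disjoint hA.pairwise_disjoint hz (hi (hsubA j hz)))
  have hnob : ∀ W : Fin 3 → Set M, ¬ IsLocalSplitting b W := by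
    intro W hW
    obtain ⟨C', hC'⟩ := exists_isExhaustion_compl_singleton b
    obtain ⟨e', he'⟩ := hW.exists_injective hconb hC'
    obtain ⟨U', F', hU', hF'⟩ := exists_isLocalSplitting_of_injective hC' he'
    obtain ⟨A', hA', -⟩ := exists_isLocalSplitting_iUnion_eq hbx.symm hgb' hg' hU' hF'
    exact hno A' hA'
  refine ⟨⟨⟨fun n => (g n)⁻¹, b, x, hbx, ?_, fun y hy => hg'.tendsto hy⟩, not_not.2 hconb,
    (valenceEq_two_iff hconb).2 ⟨⟨A, hA⟩, hnob⟩⟩,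
    numComplementaryComponents_eq_two hbx.symm hconb hno hsep⟩
  simp only [hgb']
  exact tendsto_const_nhds

end Action

/-- Let `M` be a Peano continuum and `G` a group acting on `M` as a
geometrically finite convergence group.  Then no `∼`-class in `M*(2)` is a singleton: for
every `x ∈ M*(2)` there is `y ∈ M*(2)` with `y ≠ x` and `𝒩(x,y) = 2`. -/
theorem no_singleton_simRel_class
    {G : Type*} {M : Type u} [Group G] [MetricSpace M] [CompactSpace M] [ConnectedSpace M]
    [LocallyConnectedSpace M] [MulAction G M]
    (hcont : ContinuousActionOn G M)
    (hgf : IsGeometricallyFinite G M) :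
    ∀ x ∈ Mstar2 G M, ∃ y ∈ Mstar2 G M, y ≠ x ∧
      numComplementaryComponents M x y = 2 := by
  have : ContinuousConstSMul G M := ⟨hcont⟩
  intro x hx
  obtain ⟨-, a, b, hab, -⟩ := hx.1
  have : Nontrivial M := ⟨a, b, hab⟩
  have : Infinite M := PreconnectedSpace.infinite
  obtain ⟨U, hU⟩ := ((valenceEq_two_iff (not_not.1 hx.2.1)).1 hx.2.2).1
  obtain ⟨g, α, β, hαβ, hgx, hg⟩ := hx.1.exists_tendstoLocallyUniformlyAway hgf.1
  by_cases hne : ∀ᶠ n in atTop, g n • x ≠ α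
  · obtain ⟨n, m, hnm, hsep⟩ := exists_not_isPreconnected_compl_pair hαβ hgx hne hg hU
    have hy : ((g n)⁻¹ * g m) • x ∈ Mstar2 G M := smul_mem_Mstar2 hx _
    have hyx : ((g n)⁻¹ * g m) • x ≠ x := by
      rw [mul_smul, Ne, inv_smul_eq_iff]
      exact hnm.symm
    refine ⟨_, hy, hyx, numComplementaryComponents_eq_two hyx.symm (not_not.1 hy.2.1)
      ((valenceEq_two_iff (not_not.1 hx.2.1)).1 hx.2.2).2 fun hconn => hsep ?_⟩
    have := hconn.image _ (continuous_const_smul (g n)).continuousOn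
    rw [Set.image_smul, Set.smul_set_compl, Set.smul_set_insert, Set.smul_set_singleton,
      mul_smul, smul_inv_smul] at this
    exact this
  · have hfreq : ∃ᶠ n in atTop, g n • x = α := by simpa [Filter.Frequently] using hne
    obtain ⟨b, hbx, f, hfx, hfb, hf, hf'⟩ := exists_zoom_of_frequently_eq hgf.1 hαβ hg hfreq
    obtain ⟨hb, hN⟩ := mem_Mstar2_and_numComplementaryComponents_eq_two hx hbx hfx hfb hf hf'
    exact ⟨b, hb, hbx, hN⟩
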